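/- Let ξ ∈ ℝ with −α < ξ < 0 and Λ G(ξ) ≤ λ G(α), and let u ∈ C²([0,R)) with u(0) = ξ and u'(0) = 0 be the solution of the radial Pucci equation for M⁻ on its maximal interval of existence [0,R). Then R = +∞, u is oscillating (it has an unbounded sequence of zeros), u is localized (u(r), u'(r), u''(r) → 0 as r → +∞), and sup_{r ≥ 0} |u(r)| < α. -/

import Mathlib

open Set Filter Topology

section ODEContinuation

variable {E : Type*} [NormedAddCommGroup E] [NormedSpace ℝ E] [CompleteSpace E]

/-- Local existence for `x' = f t x` when `f` is Lipschitz in `(t, x)` near the initial point. -/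
lemma exists_local_solution_of_lipschitzOnWith (f : ℝ → E → E) (t₀ : ℝ) (x₀ : E) {K : NNReal}
    {s : Set (ℝ × E)} (hs : s ∈ 𝓝 (t₀, x₀))
    (hf : LipschitzOnWith K (fun q : ℝ × E => f q.1 q.2) s) :
    ∃ w : ℝ → E, w t₀ = x₀ ∧ ∃ ε > 0, ∀ t ∈ Ioo (t₀ - ε) (t₀ + ε),
      HasDerivAt w (f t (w t)) t := by
  obtain ⟨a, ha, has⟩ := Metric.nhds_basis_closedBall.mem_iff.1 hs
  set L : ℝ := K * a + ‖f t₀ x₀‖ + 1 with hL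
  have hL0 : 0 < L := by positivity
  set ε := min a (a / L) with hε
  have hε0 : 0 < ε := lt_min ha (div_pos ha hL0)
  have hmem : ∀ t ∈ Icc (t₀ - ε) (t₀ + ε), ∀ x ∈ Metric.closedBall x₀ a, (t, x) ∈ s := by
    intro t ht x hx
    refine has ?_
    rw [← closedBall_prod_same]
    refine ⟨?_, hx⟩
    rw [Real.closedBall_eq_Icc]
    exact ⟨by linarith [ht.1, min_le_left a (a / L)], by linarith [ht.2, min_le_left a (a / L)]⟩
  have hpl : IsPicardLindelof f (tmin := t₀ - ε) (tmax := t₀ + ε)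
      ⟨t₀, by constructor <;> linarith⟩ x₀ ⟨a, ha.le⟩ 0 ⟨L, hL0.le⟩ K := by
    refine ⟨?_, ?_, ?_, ?_⟩
    · intro t ht x hx y hy
      have := hf (hmem t ht x hx) (hmem t ht y hy)
      simpa [Prod.edist_eq] using this
    · intro x hx
      exact hf.continuousOn.comp (f := fun t => (t, x)) (by fun_prop) fun t ht => hmem t ht x hx
    · intro t ht x hx
      have h1 := hmem t ht x hx
      have h := hf.norm_sub_le h1 (mem_of_mem_nhds hs)
      have h2 : ‖(t, x) - (t₀, x₀)‖ ≤ a := by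
        rw [← dist_eq_norm, Prod.dist_eq]
        refine max_le ?_ hx
        rw [Real.dist_eq, abs_le]
        exact ⟨by linarith [ht.1, min_le_left a (a / L)],
          by linarith [ht.2, min_le_left a (a / L)]⟩
      calc ‖f t x‖ ≤ ‖f t x - f t₀ x₀‖ + ‖f t₀ x₀‖ := norm_le_norm_sub_add _ _
        _ ≤ K * a + ‖f t₀ x₀‖ := by
          gcongr
          exact h.trans (by gcongr)
        _ ≤ L := by rw [hL]; linarith
    · have : ε * L ≤ a := by
        rw [← le_div_iff₀ hL0]; exact min_le_right _ _
      simp only [add_sub_cancel_left, sub_sub_cancel, max_self, NNReal.coe_zero, sub_zero]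
      change L * ε ≤ a
      linarith
  obtain ⟨w, hw0, hw⟩ := hpl.exists_eq_forall_mem_Icc_hasDerivWithinAt₀
  exact ⟨w, hw0, ε, hε0, fun t ht =>
    (hw t (Ioo_subset_Icc_self ht)).hasDerivAt (Icc_mem_nhds ht.1 ht.2)⟩

/-- A solution which has a limit at the right end of its interval extends past that end. -/
lemma exists_extension_of_tendsto (f : ℝ → E → E) (U : ℝ → E) {a b : ℝ} (hab : a < b) (x₀ : E)
    (hU : ∀ t ∈ Ioo a b, HasDerivAt U (f t (U t)) t) (hlim : Tendsto U (𝓝[<] b) (𝓝 x₀))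
    {K : NNReal} {s : Set (ℝ × E)} (hs : s ∈ 𝓝 (b, x₀))
    (hf : LipschitzOnWith K (fun q : ℝ × E => f q.1 q.2) s) :
    ∃ c > b, ∃ V : ℝ → E, (∀ t < b, V t = U t) ∧
      ∀ t ∈ Ioo a c, HasDerivAt V (f t (V t)) t := by
  obtain ⟨w, hw0, ε, hε, hw⟩ := exists_local_solution_of_lipschitzOnWith f b x₀ hs hf
  set V : ℝ → E := fun t => if t < b then U t else w t with hV
  have hVlt : ∀ t < b, V t = U t := fun t ht => by simp [hV, ht]
  have hVge : ∀ t, b ≤ t → V t = w t := fun t ht => by simp [hV, not_lt.2 ht]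
  have hVb : V b = x₀ := by rw [hVge b le_rfl, hw0]
  have hVeq : ∀ t < b, V =ᶠ[𝓝 t] U := fun t ht => by
    filter_upwards [Iio_mem_nhds ht] with y hy using hVlt y hy
  have hlow : ∀ t ∈ Ioo a b, HasDerivAt V (f t (V t)) t := fun t ht => by
    rw [hVlt t ht.2]
    exact (hU t ht).congr_of_eventuallyEq (hVeq t ht.2)
  have hev : V =ᶠ[𝓝[<] b] U := by
    filter_upwards [self_mem_nhdsWithin] with y hy using hVlt y hy
  have hVlim : Tendsto V (𝓝[<] b) (𝓝 x₀) := hlim.congr' hev.symm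
  refine ⟨b + ε, by linarith, V, hVlt, fun t ht => ?_⟩
  rcases lt_trichotomy t b with h | h | h
  · exact hlow t ⟨ht.1, h⟩
  · subst h
    have hIoo : Ioo a t ∈ 𝓝[<] t := Ioo_mem_nhdsLT hab
    have hleft : HasDerivWithinAt V (f t (V t)) (Iic t) t := by
      refine hasDerivWithinAt_Iic_of_tendsto_deriv (s := Ioo a t)
        (fun y hy => (hlow y hy).differentiableAt.differentiableWithinAt) ?_ hIoo ?_
      · rw [ContinuousWithinAt, hVb]
        exact hVlim.mono_left (nhdsWithin_mono _ fun y hy => hy.2)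
      · have hc : ContinuousAt (fun q : ℝ × E => f q.1 q.2) (t, x₀) :=
          hf.continuousOn.continuousAt hs
        have hp : Tendsto (fun y => (y, V y)) (𝓝[<] t) (𝓝 (t, x₀)) :=
          (tendsto_id.mono_left nhdsWithin_le_nhds).prodMk_nhds hVlim
        rw [hVb]
        refine (hc.tendsto.comp hp).congr' ?_
        filter_upwards [hIoo] with y hy using (hlow y hy).deriv.symm
    have hright : HasDerivWithinAt V (f t (V t)) (Ici t) t := by
      have h1 := (hw t ⟨by linarith, by linarith⟩).hasDerivWithinAt (s := Ici t)
      rw [hVge t le_rfl]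
      exact h1.congr (fun y hy => hVge y hy) (hVge t le_rfl)
    have := hleft.union hright
    rwa [Iic_union_Ici, hasDerivWithinAt_univ] at this
  · rw [hVge t h.le]
    refine (hw t ⟨by linarith, ht.2⟩).congr_of_eventuallyEq ?_
    filter_upwards [Ioi_mem_nhds h] with y hy using hVge y (le_of_lt hy)

end ODEContinuation

lemma exists_tendsto_left_of_hasDerivAt_bounded {f f' : ℝ → ℝ} {a b C : ℝ} (hab : a < b)
    (hf : ∀ t ∈ Ioo a b, HasDerivAt f (f' t) t) (hC : ∀ t ∈ Ioo a b, |f' t| ≤ C) :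
    ∃ l, Tendsto f (𝓝[<] b) (𝓝 l) := by
  have hC0 : 0 ≤ C :=
    (abs_nonneg _).trans (hC ((a + b) / 2) ⟨by linarith, by linarith⟩)
  have hlip : LipschitzOnWith ⟨C, hC0⟩ f (Ioo a b) :=
    (convex_Ioo a b).lipschitzOnWith_of_nnnorm_hasDerivWithin_le
      (fun t ht => (hf t ht).hasDerivWithinAt) fun t ht => hC t ht
  obtain ⟨k, hk, hkf⟩ := hlip.extend_real
  refine ⟨k b, (hk.continuous.continuousAt.tendsto.mono_left nhdsWithin_le_nhds).congr' ?_⟩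
  filter_upwards [Ioo_mem_nhdsLT hab] with y hy using (hkf hy).symm

/-- The inverse of `y ↦ (if 0 ≤ y then lam else Lam) * y`. -/
noncomputable def pucciInv (lam Lam z : ℝ) : ℝ := max (z / lam) (z / Lam)

/-- The map `y ↦ (if 0 ≤ y then lam else Lam) * y`, see `pucciDrift_eq`. -/
noncomputable def pucciDrift (lam Lam y : ℝ) : ℝ := min (lam * y) (Lam * y)

/-- The right-hand side of the radial Pucci equation solved for `u''`. -/
noncomputable def pucciField (lam Lam ν : ℝ) (g : ℝ → ℝ) (r x y : ℝ) : ℝ :=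
  pucciInv lam Lam (-(g x + pucciDrift lam Lam (ν * y / r)))

/-- The autonomous force, so that the limit equation reads `u'' = -pucciForce u`. -/
noncomputable def pucciForce (lam Lam : ℝ) (g : ℝ → ℝ) (x : ℝ) : ℝ := -pucciInv lam Lam (-g x)

/-- The primitive of `pucciForce` vanishing at `0`. -/
noncomputable def pucciPotential (lam Lam : ℝ) (g : ℝ → ℝ) (t : ℝ) : ℝ :=
  ∫ s in (0 : ℝ)..t, pucciForce lam Lam g s

section Algebra

variable {lam Lam : ℝ}

lemma pucciDrift_eq (hL : lam ≤ Lam) (y : ℝ) :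
    pucciDrift lam Lam y = (if 0 ≤ y then lam else Lam) * y := by
  unfold pucciDrift
  split_ifs with h
  · exact min_eq_left (mul_le_mul_of_nonneg_right hL h)
  · exact min_eq_right (mul_le_mul_of_nonpos_right hL (not_le.1 h).le)

lemma pucciDrift_mul (hL : lam ≤ Lam) {c : ℝ} (hc : 0 < c) (y : ℝ) :
    pucciDrift lam Lam (c * y) = c * pucciDrift lam Lam y := by
  rw [pucciDrift_eq hL, pucciDrift_eq hL]
  simp only [mul_nonneg_iff_of_pos_left hc]
  ring

lemma pucciInv_of_nonneg (hlam : 0 < lam) (hL : lam ≤ Lam) {z : ℝ} (hz : 0 ≤ z) :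
    pucciInv lam Lam z = z / lam :=
  max_eq_left (div_le_div_of_nonneg_left hz hlam hL)

lemma pucciInv_of_nonpos (hlam : 0 < lam) (hL : lam ≤ Lam) {z : ℝ} (hz : z ≤ 0) :
    pucciInv lam Lam z = z / Lam := by
  refine max_eq_right ?_
  have := div_le_div_of_nonneg_left (neg_nonneg.2 hz) hlam hL
  simp only [neg_div] at this
  linarith

lemma eq_pucciInv_iff (hlam : 0 < lam) (hL : lam ≤ Lam) (q z : ℝ) :
    (if 0 ≤ q then lam else Lam) * q = z ↔ q = pucciInv lam Lam z := by
  have hLam := hlam.trans_le hL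
  rcases le_or_gt 0 z with hz | hz
  · rw [pucciInv_of_nonneg hlam hL hz, eq_div_iff hlam.ne']
    split_ifs with h
    · rw [mul_comm]
    · have h := not_le.1 h
      constructor <;> intro h' <;> nlinarith
  · rw [pucciInv_of_nonpos hlam hL hz.le, eq_div_iff hLam.ne']
    split_ifs with h
    · constructor <;> intro h' <;> nlinarith
    · rw [mul_comm]

lemma pucci_equation_iff (hlam : 0 < lam) (hL : lam ≤ Lam) {ν r : ℝ} (hν : 0 < ν) (hr : 0 < r)
    (g : ℝ → ℝ) (x y q : ℝ) :
    (if 0 ≤ q then lam else Lam) * q + ν / r * ((if 0 ≤ y then lam else Lam) * y) + g x = 0 ↔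
      q = pucciField lam Lam ν g r x y := by
  rw [pucciField, ← eq_pucciInv_iff hlam hL, mul_div_right_comm,
    pucciDrift_mul hL (div_pos hν hr), pucciDrift_eq hL]
  constructor <;> intro h <;> linarith

lemma pucciInv_sub_le (hlam : 0 < lam) (hL : lam ≤ Lam) {a b : ℝ} (hab : a ≤ b) :
    pucciInv lam Lam b - pucciInv lam Lam a ≤ (b - a) / lam := by
  have hLam := hlam.trans_le hL
  have h1 : (b - a) / Lam ≤ (b - a) / lam := div_le_div_of_nonneg_left (by linarith) hlam hL
  have h2 := le_max_left (a / lam) (a / Lam)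
  have h3 := le_max_right (a / lam) (a / Lam)
  unfold pucciInv
  rw [sub_div, sub_div] at h1
  rw [sub_div, sub_le_iff_le_add]
  exact max_le (by linarith) (by linarith)

lemma le_pucciInv_sub (hlam : 0 < lam) (hL : lam ≤ Lam) {a b : ℝ} (hab : a ≤ b) :
    (b - a) / Lam ≤ pucciInv lam Lam b - pucciInv lam Lam a := by
  have h1 : (b - a) / Lam ≤ (b - a) / lam := div_le_div_of_nonneg_left (by linarith) hlam hL
  have h2 := le_max_left (b / lam) (b / Lam)
  have h3 := le_max_right (b / lam) (b / Lam)
  unfold pucciInv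
  rw [sub_div, sub_div] at h1
  rw [sub_div, le_sub_comm]
  exact max_le (by linarith) (by linarith)

lemma abs_pucciInv_sub_le (hlam : 0 < lam) (hL : lam ≤ Lam) (a b : ℝ) :
    |pucciInv lam Lam a - pucciInv lam Lam b| ≤ |a - b| / lam := by
  have hLam := hlam.trans_le hL
  wlog hab : b ≤ a generalizing a b
  · rw [abs_sub_comm, abs_sub_comm a b]
    exact this b a (not_le.1 hab).le
  have h0 : 0 ≤ (a - b) / Lam := div_nonneg (by linarith) hLam.le
  have h1 := le_pucciInv_sub hlam hL hab
  rw [abs_of_nonneg (by linarith), abs_of_nonneg (by linarith)]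
  exact pucciInv_sub_le hlam hL hab

lemma abs_pucciDrift_le (hlam : 0 < lam) (hL : lam ≤ Lam) (y : ℝ) :
    |pucciDrift lam Lam y| ≤ Lam * |y| := by
  rw [pucciDrift_eq hL, abs_mul]
  refine mul_le_mul_of_nonneg_right ?_ (abs_nonneg y)
  split_ifs
  · rwa [abs_of_pos hlam]
  · rw [abs_of_pos (hlam.trans_le hL)]

lemma lipschitzWith_pucciInv (hlam : 0 < lam) (hL : lam ≤ Lam) :
    LipschitzWith ⟨1 / lam, by positivity⟩ (pucciInv lam Lam) :=
  LipschitzWith.of_dist_le_mul fun a b => by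
    rw [Real.dist_eq, Real.dist_eq]
    refine (abs_pucciInv_sub_le hlam hL a b).trans_eq ?_
    rw [div_eq_inv_mul, ← one_div]
    rfl

lemma lipschitzWith_pucciDrift (lam Lam : ℝ) :
    LipschitzWith (max ‖lam‖₊ ‖Lam‖₊) (pucciDrift lam Lam) :=
  (lipschitzWith_smul lam).min (lipschitzWith_smul Lam)

lemma abs_pucciField_add_pucciForce_le (hlam : 0 < lam) (hL : lam ≤ Lam) {ν r : ℝ} (hν : 0 < ν)
    (hr : 0 < r) (g : ℝ → ℝ) (x y : ℝ) :
    |pucciField lam Lam ν g r x y + pucciForce lam Lam g x| ≤ Lam * ν / lam * (|y| / r) := by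
  rw [pucciField, pucciForce, ← sub_eq_add_neg]
  refine (abs_pucciInv_sub_le hlam hL _ _).trans ?_
  rw [show -(g x + pucciDrift lam Lam (ν * y / r)) - -g x = -pucciDrift lam Lam (ν * y / r) by
    ring, abs_neg]
  have := abs_pucciDrift_le hlam hL (ν * y / r)
  rw [abs_div, abs_mul, abs_of_pos hr, abs_of_pos hν] at this
  calc _ ≤ Lam * (ν * |y| / r) / lam := by gcongr
    _ = _ := by ring

lemma mul_pucciField_add_le (hlam : 0 < lam) (hL : lam ≤ Lam) {ν r : ℝ} (hν : 1 ≤ ν)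
    (hr : 0 < r) (g : ℝ → ℝ) (x y : ℝ) :
    y * pucciField lam Lam ν g r x y + pucciForce lam Lam g x * y ≤ -(lam / Lam) * (y ^ 2 / r) := by
  have hLam := hlam.trans_le hL
  have hν0 : 0 < ν := by linarith
  rw [pucciField, pucciForce, mul_div_right_comm, pucciDrift_mul hL (div_pos hν0 hr)]
  set k := ν / r with hk
  have hkr : 1 / r ≤ k := by rw [hk]; gcongr
  have hk0 : 0 < k := div_pos hν0 hr
  have key : y * pucciInv lam Lam (-(g x + k * pucciDrift lam Lam y))
      + -pucciInv lam Lam (-g x) * y ≤ -(lam / Lam) * (k * y ^ 2) := by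
    rcases le_or_gt 0 y with hy | hy
    · have h1 := le_pucciInv_sub hlam hL (a := -(g x + k * (lam * y))) (b := -g x)
        (by have : 0 ≤ k * (lam * y) := by positivity
            linarith)
      rw [pucciDrift_eq hL, if_pos hy]
      have h2 := mul_le_mul_of_nonneg_left h1 hy
      have h3 : y * ((-g x - -(g x + k * (lam * y))) / Lam) = lam / Lam * (k * y ^ 2) := by ring
      linarith
    · have h1 := le_pucciInv_sub hlam hL (b := -(g x + k * (Lam * y))) (a := -g x)
        (by have : k * (Lam * y) ≤ 0 :=
              mul_nonpos_of_nonneg_of_nonpos hk0.le (mul_nonpos_of_nonneg_of_nonpos hLam.le hy.le)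
            linarith)
      rw [pucciDrift_eq hL, if_neg (not_le.2 hy)]
      have h2 := mul_le_mul_of_nonpos_left h1 hy.le
      have h3 : y * ((-(g x + k * (Lam * y)) - -g x) / Lam) = -(k * y ^ 2) := by
        field_simp; ring
      have h4 : lam / Lam * (k * y ^ 2) ≤ 1 * (k * y ^ 2) := by
        gcongr
        rwa [div_le_one hLam]
      linarith
  refine key.trans ?_
  have h5 : y ^ 2 / r ≤ k * y ^ 2 := by
    calc y ^ 2 / r = 1 / r * y ^ 2 := by ring
      _ ≤ _ := by gcongr
  have h6 : lam / Lam * (y ^ 2 / r) ≤ lam / Lam * (k * y ^ 2) := by gcongr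
  linarith

lemma exists_lipschitzOnWith_pucci_system (hlam : 0 < lam) (hL : lam ≤ Lam) (ν : ℝ) {g : ℝ → ℝ}
    (hg : LocallyLipschitz g) {b : ℝ} (hb : 0 < b) (x₀ : ℝ × ℝ) :
    ∃ K : NNReal, ∃ s ∈ 𝓝 (b, x₀), LipschitzOnWith K
      (fun q : ℝ × ℝ × ℝ => (q.2.2, pucciField lam Lam ν g q.1 q.2.1 q.2.2)) s := by
  obtain ⟨K₁, s₁, hs₁, h₁⟩ := hg x₀.1
  have hC : ContDiffAt ℝ 1 (fun q : ℝ × ℝ × ℝ => ν * q.2.2 / q.1) (b, x₀) := by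
    refine ContDiffAt.div (by fun_prop) (by fun_prop) hb.ne'
  obtain ⟨K₂, s₂, hs₂, h₂⟩ := hC.exists_lipschitzOnWith
  have hs₁' : (fun q : ℝ × ℝ × ℝ => q.2.1) ⁻¹' s₁ ∈ 𝓝 (b, x₀) :=
    (show Continuous fun q : ℝ × ℝ × ℝ => q.2.1 by fun_prop).continuousAt hs₁
  have hfst : LipschitzWith 1 (fun q : ℝ × ℝ × ℝ => q.2.1) := by
    simpa [Function.comp_def] using
      LipschitzWith.prod_fst.comp (LipschitzWith.prod_snd (α := ℝ) (β := ℝ × ℝ))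
  have hsnd : LipschitzWith 1 (fun q : ℝ × ℝ × ℝ => q.2.2) := by
    simpa [Function.comp_def] using
      LipschitzWith.prod_snd.comp (LipschitzWith.prod_snd (α := ℝ) (β := ℝ × ℝ))
  have hgs := h₁.comp (hfst.lipschitzOnWith (s := (fun q : ℝ × ℝ × ℝ => q.2.1) ⁻¹' s₁ ∩ s₂))
    fun q hq => hq.1
  have hds := (lipschitzWith_pucciDrift lam Lam).comp_lipschitzOnWith
    (h₂.mono (inter_subset_right (s := (fun q : ℝ × ℝ × ℝ => q.2.1) ⁻¹' s₁)))
  have hF := (lipschitzWith_pucciInv hlam hL).comp_lipschitzOnWith (hgs.add hds).neg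
  exact ⟨_, _, inter_mem hs₁' hs₂, hsnd.lipschitzOnWith.prodMk hF⟩

end Algebra

/-- Standing assumptions on the constants and the nonlinearity. -/
structure PucciData (lam Lam ν α : ℝ) (g : ℝ → ℝ) : Prop where
  lam_pos : 0 < lam
  lam_le : lam ≤ Lam
  one_le : 1 ≤ ν
  alpha_pos : 0 < α
  lip : LocallyLipschitz g
  g_zero : g 0 = 0
  g_pos : ∀ x, 0 < x → x < α → 0 < g x
  g_neg : ∀ x, -α < x → x < 0 → g x < 0

namespace PucciData

variable {lam Lam ν α : ℝ} {g : ℝ → ℝ}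

lemma Lam_pos (h : PucciData lam Lam ν α g) : 0 < Lam := h.lam_pos.trans_le h.lam_le

lemma continuous_force (h : PucciData lam Lam ν α g) : Continuous (pucciForce lam Lam g) :=
  ((lipschitzWith_pucciInv h.lam_pos h.lam_le).continuous.comp h.lip.continuous.neg).neg

lemma force_of_nonneg (h : PucciData lam Lam ν α g) {x : ℝ} (hx : 0 ≤ g x) :
    pucciForce lam Lam g x = g x / Lam := by
  rw [pucciForce, pucciInv_of_nonpos h.lam_pos h.lam_le (by linarith), neg_div, neg_neg]

lemma force_of_nonpos (h : PucciData lam Lam ν α g) {x : ℝ} (hx : g x ≤ 0) :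
    pucciForce lam Lam g x = g x / lam := by
  rw [pucciForce, pucciInv_of_nonneg h.lam_pos h.lam_le (by linarith), neg_div, neg_neg]

lemma force_zero (h : PucciData lam Lam ν α g) : pucciForce lam Lam g 0 = 0 := by
  rw [h.force_of_nonneg h.g_zero.ge, h.g_zero, zero_div]

lemma force_pos (h : PucciData lam Lam ν α g) {x : ℝ} (hx : 0 < x) (hxα : x < α) :
    0 < pucciForce lam Lam g x := by
  have := h.g_pos x hx hxα
  rw [h.force_of_nonneg this.le]
  exact div_pos this h.Lam_pos

lemma force_neg (h : PucciData lam Lam ν α g) {x : ℝ} (hxα : -α < x) (hx : x < 0) :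
    pucciForce lam Lam g x < 0 := by
  have := h.g_neg x hxα hx
  rw [h.force_of_nonpos this.le]
  exact div_neg_of_neg_of_pos this h.lam_pos

lemma mul_force_pos (h : PucciData lam Lam ν α g) {x : ℝ} (hx : |x| < α) (hx0 : x ≠ 0) :
    0 < x * pucciForce lam Lam g x := by
  rcases lt_or_gt_of_ne hx0 with h0 | h0
  · exact mul_pos_of_neg_of_neg h0 (h.force_neg (abs_lt.1 hx).1 h0)
  · exact mul_pos h0 (h.force_pos h0 (abs_lt.1 hx).2)

lemma mul_div_le_mul_force (h : PucciData lam Lam ν α g) {x : ℝ} (hx : |x| < α) :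
    x * g x / Lam ≤ x * pucciForce lam Lam g x := by
  rcases lt_trichotomy x 0 with h0 | h0 | h0
  · have := h.g_neg x (abs_lt.1 hx).1 h0
    rw [h.force_of_nonpos this.le, ← mul_div_assoc]
    exact div_le_div_of_nonneg_left (mul_pos_of_neg_of_neg h0 this).le h.lam_pos h.lam_le
  · simp [h0]
  · rw [h.force_of_nonneg (h.g_pos x h0 (abs_lt.1 hx).2).le, ← mul_div_assoc]

lemma hasDerivAt_potential (h : PucciData lam Lam ν α g) (x : ℝ) :
    HasDerivAt (pucciPotential lam Lam g) (pucciForce lam Lam g x) x :=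
  h.continuous_force.integral_hasStrictDerivAt 0 x |>.hasDerivAt

lemma continuous_potential (h : PucciData lam Lam ν α g) : Continuous (pucciPotential lam Lam g) :=
  continuous_iff_continuousAt.2 fun x => (h.hasDerivAt_potential x).continuousAt

lemma potential_zero : pucciPotential lam Lam g 0 = 0 := by simp [pucciPotential]

lemma strictMonoOn_potential (h : PucciData lam Lam ν α g) :
    StrictMonoOn (pucciPotential lam Lam g) (Icc 0 α) := by
  refine strictMonoOn_of_deriv_pos (convex_Icc 0 α) h.continuous_potential.continuousOn ?_
  intro x hx
  rw [interior_Icc] at hx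
  rw [(h.hasDerivAt_potential x).deriv]
  exact h.force_pos hx.1 hx.2

lemma strictAntiOn_potential (h : PucciData lam Lam ν α g) :
    StrictAntiOn (pucciPotential lam Lam g) (Icc (-α) 0) := by
  refine strictAntiOn_of_deriv_neg (convex_Icc (-α) 0) h.continuous_potential.continuousOn ?_
  intro x hx
  rw [interior_Icc] at hx
  rw [(h.hasDerivAt_potential x).deriv]
  exact h.force_neg hx.1 hx.2

lemma potential_pos (h : PucciData lam Lam ν α g) {x : ℝ} (hx : |x| ≤ α) (hx0 : x ≠ 0) :
    0 < pucciPotential lam Lam g x := by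
  have hα := h.alpha_pos
  obtain ⟨h1, h2⟩ := abs_le.1 hx
  rw [← potential_zero (lam := lam) (Lam := Lam) (g := g)]
  rcases lt_or_gt_of_ne hx0 with h0 | h0
  · exact h.strictAntiOn_potential ⟨h1, h0.le⟩ ⟨by linarith, le_rfl⟩ h0
  · exact h.strictMonoOn_potential ⟨le_rfl, hα.le⟩ ⟨h0.le, h2⟩ h0

lemma potential_nonneg (h : PucciData lam Lam ν α g) {x : ℝ} (hx : |x| ≤ α) :
    0 ≤ pucciPotential lam Lam g x := by
  rcases eq_or_ne x 0 with rfl | hx0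
  · rw [potential_zero]
  · exact (h.potential_pos hx hx0).le

lemma g_alpha_nonneg (h : PucciData lam Lam ν α g) : 0 ≤ g α := by
  refine ge_of_tendsto (h.lip.continuous.continuousAt.tendsto.mono_left
    (nhdsWithin_le_nhds (s := Iio α))) ?_
  filter_upwards [Ioo_mem_nhdsLT h.alpha_pos] with x hx using (h.g_pos x hx.1 hx.2).le

lemma potential_alpha (h : PucciData lam Lam ν α g) :
    pucciPotential lam Lam g α = (∫ s in (0 : ℝ)..α, g s) / Lam := by
  rw [pucciPotential, ← intervalIntegral.integral_div]
  refine intervalIntegral.integral_congr fun x hx => ?_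
  rw [uIcc_of_le h.alpha_pos.le] at hx
  refine h.force_of_nonneg ?_
  rcases eq_or_lt_of_le hx.1 with h0 | h0
  · rw [← h0, h.g_zero]
  rcases eq_or_lt_of_le hx.2 with h1 | h1
  · rw [h1]; exact h.g_alpha_nonneg
  · exact (h.g_pos x h0 h1).le

lemma potential_of_neg (h : PucciData lam Lam ν α g) {ξ : ℝ} (hξ : -α < ξ) (hξ0 : ξ < 0) :
    pucciPotential lam Lam g ξ = (∫ s in (0 : ℝ)..ξ, g s) / lam := by
  rw [pucciPotential, ← intervalIntegral.integral_div]
  refine intervalIntegral.integral_congr fun x hx => ?_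
  rw [uIcc_of_ge hξ0.le] at hx
  refine h.force_of_nonpos ?_
  rcases eq_or_lt_of_le hx.2 with h0 | h0
  · rw [h0, h.g_zero]
  · exact (h.g_neg x (by linarith [hx.1]) h0).le

end PucciData

/-- The mechanical energy, a Lyapunov function of the radial equation. -/
noncomputable def pucciEnergy (lam Lam : ℝ) (g u p : ℝ → ℝ) (r : ℝ) : ℝ :=
  p r ^ 2 / 2 + pucciPotential lam Lam g (u r)

/-- `u`, with derivative `p`, solves the radial equation on `[0, b)` and starts at rest from a
negative value whose potential does not exceed that of `α`. -/
structure PucciSolution (lam Lam ν α : ℝ) (g : ℝ → ℝ) (b : EReal) (u p : ℝ → ℝ) : Prop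
    extends PucciData lam Lam ν α g where
  u_cont : ContinuousOn u {r : ℝ | 0 ≤ r ∧ (r : EReal) < b}
  p_cont : ContinuousOn p {r : ℝ | 0 ≤ r ∧ (r : EReal) < b}
  p_zero : p 0 = 0
  u_deriv : ∀ r : ℝ, 0 < r → (r : EReal) < b → HasDerivAt u (p r) r
  p_deriv : ∀ r : ℝ, 0 < r → (r : EReal) < b →
    HasDerivAt p (pucciField lam Lam ν g r (u r) (p r)) r
  u_zero_gt : -α < u 0
  u_zero_lt : u 0 < 0
  potential_le : pucciPotential lam Lam g (u 0) ≤ pucciPotential lam Lam g α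

namespace PucciSolution

variable {lam Lam ν α : ℝ} {g : ℝ → ℝ} {b : EReal} {u p : ℝ → ℝ}

lemma Icc_subset {r : ℝ} (hrb : (r : EReal) < b) :
    Icc 0 r ⊆ {r : ℝ | 0 ≤ r ∧ (r : EReal) < b} :=
  fun _ hs => ⟨hs.1, (EReal.coe_le_coe_iff.2 hs.2).trans_lt hrb⟩

lemma hasDerivAt_energy (h : PucciSolution lam Lam ν α g b u p) {r : ℝ} (hr : 0 < r)
    (hrb : (r : EReal) < b) :
    HasDerivAt (pucciEnergy lam Lam g u p)
      (p r * pucciField lam Lam ν g r (u r) (p r) + pucciForce lam Lam g (u r) * p r) r := by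
  have h1 := (((h.p_deriv r hr hrb).pow 2).div_const 2).add
    ((h.hasDerivAt_potential (u r)).comp r (h.u_deriv r hr hrb))
  refine h1.congr_deriv ?_
  push_cast
  ring

lemma deriv_energy_le (h : PucciSolution lam Lam ν α g b u p) {r : ℝ} (hr : 0 < r) :
    p r * pucciField lam Lam ν g r (u r) (p r) + pucciForce lam Lam g (u r) * p r
      ≤ -(lam / Lam) * (p r ^ 2 / r) :=
  mul_pucciField_add_le h.lam_pos h.lam_le h.one_le hr g (u r) (p r)

lemma continuousOn_energy (h : PucciSolution lam Lam ν α g b u p) :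
    ContinuousOn (pucciEnergy lam Lam g u p) {r : ℝ | 0 ≤ r ∧ (r : EReal) < b} :=
  ((h.p_cont.pow 2).div_const 2).add (h.continuous_potential.comp_continuousOn h.u_cont)

lemma antitoneOn_energy (h : PucciSolution lam Lam ν α g b u p) {c : ℝ} (hcb : (c : EReal) < b) :
    AntitoneOn (pucciEnergy lam Lam g u p) (Icc 0 c) := by
  have hsub := Icc_subset hcb
  refine antitoneOn_of_hasDerivWithinAt_nonpos (convex_Icc 0 c) (h.continuousOn_energy.mono hsub)
    (f' := fun r => p r * pucciField lam Lam ν g r (u r) (p r) + pucciForce lam Lam g (u r) * p r)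
    ?_ ?_
  · intro r hr
    rw [interior_Icc] at hr
    exact (h.hasDerivAt_energy hr.1 (hsub (Ioo_subset_Icc_self hr)).2).hasDerivWithinAt
  · intro r hr
    rw [interior_Icc] at hr
    refine (h.deriv_energy_le hr.1).trans ?_
    have := h.Lam_pos
    have := h.lam_pos
    have := hr.1
    have : 0 ≤ lam / Lam * (p r ^ 2 / r) := by positivity
    linarith

lemma energy_le (h : PucciSolution lam Lam ν α g b u p) {r s : ℝ} (hr : 0 ≤ r) (hrs : r ≤ s)
    (hsb : (s : EReal) < b) : pucciEnergy lam Lam g u p s ≤ pucciEnergy lam Lam g u p r :=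
  h.antitoneOn_energy hsb ⟨hr, hrs⟩ ⟨hr.trans hrs, le_rfl⟩ hrs

lemma energy_lt (h : PucciSolution lam Lam ν α g b u p) {r : ℝ} (hr : 0 < r)
    (hrb : (r : EReal) < b) : pucciEnergy lam Lam g u p r < pucciEnergy lam Lam g u p 0 := by
  by_contra! hcon
  have hb : ∀ s ∈ Icc 0 r, (s : EReal) < b := fun s hs => (Icc_subset hrb hs).2
  have hconst : ∀ s ∈ Icc 0 r, pucciEnergy lam Lam g u p s = pucciEnergy lam Lam g u p 0 :=
    fun s hs => le_antisymm (h.energy_le le_rfl hs.1 (hb s hs))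
      (hcon.trans (h.energy_le hs.1 hs.2 hrb))
  have hp : ∀ s ∈ Ioo 0 r, p s = 0 := by
    intro s hs
    have hs' := Ioo_subset_Icc_self hs
    have h1 := (h.hasDerivAt_energy hs.1 (hb s hs')).congr_of_eventuallyEq
      (f₁ := fun _ => pucciEnergy lam Lam g u p 0) (by
        filter_upwards [Ioo_mem_nhds hs.1 hs.2] with y hy
        exact (hconst y (Ioo_subset_Icc_self hy)).symm)
    have h2 := h1.unique (hasDerivAt_const s _)
    have h3 := h.deriv_energy_le hs.1
    rw [h2] at h3
    have hk : 0 < lam / Lam := div_pos h.lam_pos h.Lam_pos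
    by_contra hne
    have : 0 < lam / Lam * (p s ^ 2 / s) := mul_pos hk (div_pos (by positivity) hs.1)
    linarith
  have hF : ∀ s ∈ Ioo 0 r, g (u s) = 0 := by
    intro s hs
    have h1 := (h.p_deriv s hs.1 (hb s (Ioo_subset_Icc_self hs))).congr_of_eventuallyEq
      (f₁ := fun _ => (0 : ℝ)) (by
        filter_upwards [Ioo_mem_nhds hs.1 hs.2] with y hy using (hp y hy).symm)
    have h2 := h1.unique (hasDerivAt_const s _)
    rw [hp s hs] at h2
    have h3 := (pucci_equation_iff h.lam_pos h.lam_le (by linarith [h.one_le]) hs.1 g (u s) 0 0).2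
      h2.symm
    simpa using h3
  have hg0 := h.g_neg _ h.u_zero_gt h.u_zero_lt
  have hlim : Tendsto (fun s => g (u s)) (𝓝[>] 0) (𝓝 (g (u 0))) := by
    have h1 : ContinuousWithinAt u (Icc 0 r) 0 :=
      (h.u_cont.mono (Icc_subset hrb)) 0 ⟨le_rfl, hr.le⟩
    have h2 : Tendsto u (𝓝[>] 0) (𝓝 (u 0)) := by
      refine h1.tendsto.mono_left ?_
      rw [← nhdsWithin_Ioo_eq_nhdsGT hr]
      exact nhdsWithin_mono _ Ioo_subset_Icc_self
    exact h.lip.continuous.continuousAt.tendsto.comp h2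
  obtain ⟨s, hs, hs'⟩ := ((hlim.eventually (gt_mem_nhds hg0)).and (Ioo_mem_nhdsGT hr)).exists
  rw [hF s hs'] at hs
  exact lt_irrefl _ hs

lemma potential_le_energy (r : ℝ) :
    pucciPotential lam Lam g (u r) ≤ pucciEnergy lam Lam g u p r := by
  unfold pucciEnergy; nlinarith [sq_nonneg (p r)]

lemma energy_zero (h : PucciSolution lam Lam ν α g b u p) :
    pucciEnergy lam Lam g u p 0 = pucciPotential lam Lam g (u 0) := by
  simp [pucciEnergy, h.p_zero]

lemma energy_zero_le_potential (h : PucciSolution lam Lam ν α g b u p) {x : ℝ} (hx : |x| = α) :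
    pucciEnergy lam Lam g u p 0 ≤ pucciPotential lam Lam g x := by
  rw [h.energy_zero]
  have hα := h.alpha_pos
  rcases eq_or_eq_neg_of_abs_eq hx with rfl | rfl
  · exact h.potential_le
  · exact (h.strictAntiOn_potential ⟨le_rfl, by linarith⟩ ⟨h.u_zero_gt.le, h.u_zero_lt.le⟩
      h.u_zero_gt).le

lemma abs_lt_alpha (h : PucciSolution lam Lam ν α g b u p) {r : ℝ} (hr : 0 ≤ r)
    (hrb : (r : EReal) < b) : |u r| < α := by
  by_contra! hcon
  have h0 : |u 0| < α := abs_lt.2 ⟨h.u_zero_gt, h.u_zero_lt.trans h.alpha_pos⟩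
  obtain ⟨s, hs, hsα⟩ := intermediate_value_Icc hr (h.u_cont.mono (Icc_subset hrb)).abs
    ⟨h0.le, hcon⟩
  have hs0 : 0 < s := by
    rcases eq_or_lt_of_le hs.1 with h1 | h1
    · rw [← h1] at hsα; exact absurd hsα h0.ne
    · exact h1
  have h1 := h.energy_lt hs0 (Icc_subset hrb hs).2
  have h2 := h.energy_zero_le_potential hsα
  have h3 := potential_le_energy (lam := lam) (Lam := Lam) (g := g) (u := u) (p := p) s
  linarith

lemma energy_nonneg (h : PucciSolution lam Lam ν α g b u p) {r : ℝ} (hr : 0 ≤ r)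
    (hrb : (r : EReal) < b) : 0 ≤ pucciEnergy lam Lam g u p r :=
  (h.potential_nonneg (h.abs_lt_alpha hr hrb).le).trans (potential_le_energy r)

lemma abs_p_le_sqrt (h : PucciSolution lam Lam ν α g b u p) {r : ℝ} (hr : 0 ≤ r)
    (hrb : (r : EReal) < b) : |p r| ≤ √(2 * pucciEnergy lam Lam g u p r) := by
  refine Real.abs_le_sqrt ?_
  have := h.potential_nonneg (h.abs_lt_alpha hr hrb).le
  unfold pucciEnergy
  linarith

lemma abs_p_le (h : PucciSolution lam Lam ν α g b u p) {r : ℝ} (hr : 0 ≤ r)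
    (hrb : (r : EReal) < b) : |p r| ≤ √(2 * pucciEnergy lam Lam g u p 0) :=
  (h.abs_p_le_sqrt hr hrb).trans
    (Real.sqrt_le_sqrt (by linarith [h.energy_le le_rfl hr hrb]))

/-- A solution on a bounded interval extends as a solution of the first-order system. -/
lemma exists_extension {β : ℝ} (h : PucciSolution lam Lam ν α g β u p) (hβ : 0 < β) :
    ∃ c > β, ∃ v q : ℝ → ℝ, (∀ r < β, v r = u r) ∧ ∀ r ∈ Ioo 0 c,
      HasDerivAt v (q r) r ∧ HasDerivAt q (pucciField lam Lam ν g r (v r) (q r)) r := by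
  have hb : ∀ r < β, (r : EReal) < β := fun r hr => EReal.coe_lt_coe_iff.2 hr
  set P := √(2 * pucciEnergy lam Lam g u p 0)
  have hν : 0 < ν := by linarith [h.one_le]
  have hL := h.Lam_pos
  have hl := h.lam_pos
  obtain ⟨B, hB⟩ := (isCompact_Icc (a := -α) (b := α)).exists_bound_of_continuousOn
    h.continuous_force.continuousOn
  obtain ⟨x₀, hx₀⟩ := exists_tendsto_left_of_hasDerivAt_bounded hβ
    (fun r hr => h.u_deriv r hr.1 (hb r hr.2)) fun r hr => h.abs_p_le hr.1.le (hb r hr.2)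
  obtain ⟨y₀, hy₀⟩ := exists_tendsto_left_of_hasDerivAt_bounded
    (C := Lam * ν / lam * (P / (β / 2)) + B) (half_lt_self hβ)
    (fun r hr => h.p_deriv r (by linarith [hr.1]) (hb r hr.2)) fun r hr => by
      have hr0 : 0 < r := by linarith [hr.1]
      have h1 := abs_pucciField_add_pucciForce_le h.lam_pos h.lam_le hν hr0 g (u r) (p r)
      have h2 := hB (u r) (abs_le.1 (h.abs_lt_alpha hr0.le (hb r hr.2)).le)
      have h3 : |p r| / r ≤ P / (β / 2) :=
        div_le_div₀ (Real.sqrt_nonneg _) (h.abs_p_le hr0.le (hb r hr.2)) (by linarith) hr.1.le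
      have h4 : Lam * ν / lam * (|p r| / r) ≤ Lam * ν / lam * (P / (β / 2)) := by gcongr
      rw [Real.norm_eq_abs] at h2
      have h5 := abs_sub (pucciField lam Lam ν g r (u r) (p r) + pucciForce lam Lam g (u r))
        (pucciForce lam Lam g (u r))
      rw [add_sub_cancel_right] at h5
      linarith
  obtain ⟨K, s, hs, hf⟩ := exists_lipschitzOnWith_pucci_system h.lam_pos h.lam_le ν h.lip hβ
    (x₀, y₀)
  obtain ⟨c, hc, V, hV, hVd⟩ := exists_extension_of_tendsto
    (fun r x => (x.2, pucciField lam Lam ν g r x.1 x.2)) (fun r => (u r, p r)) hβ (x₀, y₀)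
    (fun r hr => (h.u_deriv r hr.1 (hb r hr.2)).prodMk (h.p_deriv r hr.1 (hb r hr.2)))
    (hx₀.prodMk_nhds hy₀) hs hf
  refine ⟨c, hc, fun r => (V r).1, fun r => (V r).2, fun r hr => by simp [hV r hr], fun r hr => ?_⟩
  have hd := (hVd r hr).hasFDerivAt
  exact ⟨hd.fst.hasDerivAt.congr_deriv (by simp), hd.snd.hasDerivAt.congr_deriv (by simp)⟩

end PucciSolution

namespace PucciSolution

variable {lam Lam ν α : ℝ} {g : ℝ → ℝ} {u p : ℝ → ℝ}

lemma exists_energy_lt (h : PucciSolution lam Lam ν α g ⊤ u p) {e : ℝ} (he : 0 < e) :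
    ∃ r, 1 ≤ r ∧ pucciEnergy lam Lam g u p r < e := by
  by_contra! hcon
  have hT : ∀ r : ℝ, (r : EReal) < ⊤ := EReal.coe_lt_top
  set P := √(2 * pucciEnergy lam Lam g u p 0) with hP
  have hP0 : 0 ≤ P := Real.sqrt_nonneg _
  have hν : 0 < ν := by linarith [h.one_le]
  have hl := h.lam_pos
  have hL := h.Lam_pos
  have hα := h.alpha_pos
  set φ : ℝ × ℝ → ℝ := fun x => x.2 ^ 2 / 2 + pucciPotential lam Lam g x.1 with hφ
  have hφc : Continuous φ := by
    have := h.continuous_potential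
    fun_prop
  set E₁ := pucciEnergy lam Lam g u p 1
  have hE₁ : E₁ < pucciEnergy lam Lam g u p 0 := h.energy_lt one_pos (hT 1)
  -- On the compact set of states with energy in `[e, E₁]` the rate `y ^ 2 + x * force x` is positive.
  set S : Set (ℝ × ℝ) := (Icc (-α) α ×ˢ Icc (-P) P) ∩ φ ⁻¹' Icc e E₁ with hS
  have hScomp : IsCompact S :=
    (isCompact_Icc.prod isCompact_Icc).inter_right (isClosed_Icc.preimage hφc)
  have hmem : ∀ r, 1 ≤ r → (u r, p r) ∈ S := by
    intro r hr
    have hr0 : 0 ≤ r := by linarith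
    exact ⟨⟨abs_le.1 (h.abs_lt_alpha hr0 (hT r)).le, abs_le.1 (h.abs_p_le hr0 (hT r))⟩,
      hcon r hr, h.energy_le zero_le_one hr (hT r)⟩
  set m : ℝ × ℝ → ℝ := fun x => x.2 ^ 2 + x.1 * pucciForce lam Lam g x.1 with hm
  have hmc : Continuous m := by
    have := h.continuous_force
    fun_prop
  obtain ⟨z, hz, hzmin⟩ := hScomp.exists_isMinOn ⟨_, hmem 1 le_rfl⟩ hmc.continuousOn
  have hmpos : 0 < m z := by
    obtain ⟨⟨hz1, -⟩, hz3, hz4⟩ := hz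
    rcases eq_or_ne z.1 0 with h0 | h0
    · have : 0 < z.2 ^ 2 := by
        simp only [hφ, h0, PucciData.potential_zero] at hz3
        linarith
      simp only [hm, h0]
      linarith
    · have hlt : |z.1| < α := by
        refine lt_of_le_of_ne (abs_le.2 hz1) fun heq => ?_
        have h1 := h.energy_zero_le_potential heq
        simp only [hφ] at hz4
        nlinarith [sq_nonneg z.2]
      have := h.mul_force_pos hlt h0
      simp only [hm]
      positivity
  set c := m z with hc
  set κ := Lam * ν / lam with hκ
  have hκ0 : 0 < κ := by positivity
  set C := α * κ * P + α * P with hC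
  have hC0 : 0 ≤ C := by positivity
  set A := 2 * (Lam / lam) with hA
  have hA0 : 0 < A := by positivity
  set W : ℝ → ℝ := fun r => A * pucciEnergy lam Lam g u p r + u r * p r / r + c * Real.log r + C / r
    with hW
  have hWd : ∀ r, 1 ≤ r → ∃ w, HasDerivAt W w r ∧ w ≤ 0 := by
    intro r hr
    have hr0 : 0 < r := by linarith
    have hu := h.u_deriv r hr0 (hT r)
    have hp := h.p_deriv r hr0 (hT r)
    set F := pucciField lam Lam ν g r (u r) (p r) with hF
    set f := pucciForce lam Lam g (u r) with hf
    refine ⟨_, ((((h.hasDerivAt_energy hr0 (hT r)).const_mul A).add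
      ((hu.mul hp).div (hasDerivAt_id r) hr0.ne')).add
      ((Real.hasDerivAt_log hr0.ne').const_mul c)).add
      ((hasDerivAt_const r C).div (hasDerivAt_id r) hr0.ne'), ?_⟩
    have hdis := mul_le_mul_of_nonneg_left (h.deriv_energy_le hr0) hA0.le
    have hA' : A * (-(lam / Lam) * (p r ^ 2 / r)) = -2 * (p r ^ 2 / r) := by
      rw [hA]; field_simp
    have hu' := (h.abs_lt_alpha hr0.le (hT r)).le
    have hp' := h.abs_p_le hr0.le (hT r)
    have hFf : u r * F ≤ α * (κ * (P / r)) - u r * f := by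
      have h1 := abs_pucciField_add_pucciForce_le h.lam_pos h.lam_le hν hr0 g (u r) (p r)
      have h2 : |u r * (F + f)| ≤ α * (κ * (P / r)) := by
        rw [abs_mul]
        exact mul_le_mul hu' (h1.trans (by gcongr)) (abs_nonneg _) hα.le
      linarith [le_abs_self (u r * (F + f))]
    have hup : -(u r * p r) ≤ α * P := by
      have : |u r * p r| ≤ α * P := by
        rw [abs_mul]; exact mul_le_mul hu' hp' (abs_nonneg _) hα.le
      linarith [neg_abs_le (u r * p r)]
    have hcm : c ≤ p r ^ 2 + u r * f := hzmin (hmem r hr)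
    rw [hA'] at hdis
    simp only [id, mul_one, zero_mul, zero_sub, Pi.mul_apply]
    have e1 : ((p r * p r + u r * F) * r - u r * p r) / r ^ 2
        = p r ^ 2 / r + (u r * F) / r + -(u r * p r) / r ^ 2 := by field_simp; ring
    have e2 : (u r * F) / r ≤ (α * (κ * (P / r)) - u r * f) / r := by gcongr
    have e3 : -(u r * p r) / r ^ 2 ≤ α * P / r ^ 2 := by gcongr
    have e4 : c / r ≤ (p r ^ 2 + u r * f) / r := by gcongr
    have e5 : (α * (κ * (P / r)) - u r * f) / r = α * κ * P / r ^ 2 - u r * f / r := by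
      field_simp
    have e6 : -C / r ^ 2 = -(α * κ * P / r ^ 2) - α * P / r ^ 2 := by rw [hC]; ring
    have e7 : (p r ^ 2 + u r * f) / r = p r ^ 2 / r + u r * f / r := by ring
    have e8 : c * r⁻¹ = c / r := rfl
    rw [e1, e6, e8]
    linarith
  have hWanti : AntitoneOn W (Ici 1) := by
    refine antitoneOn_of_deriv_nonpos (convex_Ici 1) ?_ ?_ ?_
    · intro r hr
      obtain ⟨w, hw, -⟩ := hWd r hr
      exact hw.continuousAt.continuousWithinAt
    · intro r hr
      obtain ⟨w, hw, -⟩ := hWd r (interior_subset hr)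
      exact hw.differentiableAt.differentiableWithinAt
    · intro r hr
      obtain ⟨w, hw, hw0⟩ := hWd r (interior_subset hr)
      rwa [hw.deriv]
  have hlog : ∀ r, 1 ≤ r → c * Real.log r ≤ W 1 + α * P := by
    intro r hr
    have hr0 : 0 < r := by linarith
    have h1 : W r ≤ W 1 := hWanti (mem_Ici.2 le_rfl) hr hr
    have h2 := mul_nonneg hA0.le (h.energy_nonneg hr0.le (hT r))
    have h3 : |u r * p r / r| ≤ α * P := by
      rw [abs_div, abs_mul, abs_of_pos hr0, div_le_iff₀ hr0]
      have := mul_le_mul (h.abs_lt_alpha hr0.le (hT r)).le (h.abs_p_le hr0.le (hT r))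
        (abs_nonneg _) hα.le
      have h5 : α * P * 1 ≤ α * P * r := by gcongr
      linarith
    have h4 : 0 ≤ C / r := by positivity
    have h5 := neg_abs_le (u r * p r / r)
    simp only [hW] at h1 ⊢
    linarith
  obtain ⟨r, hr1, hr2⟩ := (((Real.tendsto_log_atTop.const_mul_atTop hmpos).eventually_gt_atTop
    (W 1 + α * P)).and (eventually_ge_atTop 1)).exists
  linarith [hlog r hr2]

lemma tendsto_energy (h : PucciSolution lam Lam ν α g ⊤ u p) :
    Tendsto (pucciEnergy lam Lam g u p) atTop (𝓝 0) := by
  refine Metric.tendsto_atTop.2 fun e he => ?_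
  obtain ⟨r, hr, hre⟩ := h.exists_energy_lt he
  refine ⟨r, fun s hs => ?_⟩
  have hs0 : 0 ≤ s := by linarith
  rw [Real.dist_eq, sub_zero, abs_of_nonneg (h.energy_nonneg hs0 (EReal.coe_lt_top s))]
  exact (h.energy_le (by linarith) hs (EReal.coe_lt_top s)).trans_lt hre

lemma tendsto_p (h : PucciSolution lam Lam ν α g ⊤ u p) : Tendsto p atTop (𝓝 0) := by
  have h1 : Tendsto (fun r => √(2 * pucciEnergy lam Lam g u p r)) atTop (𝓝 0) := by
    simpa using (h.tendsto_energy.const_mul 2).sqrt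
  refine squeeze_zero_norm' ?_ h1
  filter_upwards [eventually_ge_atTop 0] with r hr using h.abs_p_le_sqrt hr (EReal.coe_lt_top r)

lemma tendsto_u (h : PucciSolution lam Lam ν α g ⊤ u p) : Tendsto u atTop (𝓝 0) := by
  have hα := h.alpha_pos
  refine Metric.tendsto_nhds.2 fun e he => ?_
  set d := min e (α / 2)
  have hd0 : 0 < d := by positivity
  have hdα : d < α := (min_le_right _ _).trans_lt (half_lt_self hα)
  have h1 := h.potential_pos (x := d) (by rw [abs_of_pos hd0]; exact hdα.le) hd0.ne'
  have h2 := h.potential_pos (x := -d) (by rw [abs_neg, abs_of_pos hd0]; exact hdα.le)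
    (neg_ne_zero.2 hd0.ne')
  filter_upwards [h.tendsto_energy.eventually_lt_const h1,
    h.tendsto_energy.eventually_lt_const h2, eventually_ge_atTop 0] with r hr1 hr2 hr0
  have h3 := potential_le_energy (lam := lam) (Lam := Lam) (g := g) (u := u) (p := p) r
  obtain ⟨h4, h5⟩ := abs_lt.1 (h.abs_lt_alpha hr0 (EReal.coe_lt_top r))
  rw [Real.dist_eq, sub_zero]
  refine lt_of_lt_of_le ?_ (min_le_left e (α / 2))
  refine abs_lt.2 ⟨?_, ?_⟩
  · by_contra! hcon
    have := h.strictAntiOn_potential.antitoneOn ⟨h4.le, by linarith⟩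
      (b := -d) ⟨by linarith, by linarith⟩ hcon
    linarith
  · by_contra! hcon
    have := h.strictMonoOn_potential.monotoneOn (a := d) ⟨hd0.le, hdα.le⟩
      ⟨by linarith, h5.le⟩ hcon
    linarith

lemma tendsto_field (h : PucciSolution lam Lam ν α g ⊤ u p) :
    Tendsto (fun r => pucciField lam Lam ν g r (u r) (p r)) atTop (𝓝 0) := by
  have hν : 0 < ν := by linarith [h.one_le]
  have h1 : Tendsto (fun r => pucciForce lam Lam g (u r)) atTop (𝓝 0) := by
    have := h.continuous_force.continuousAt.tendsto.comp h.tendsto_u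
    rwa [h.force_zero] at this
  have h2 : Tendsto (fun r => Lam * ν / lam * (|p r| / r)) atTop (𝓝 0) := by
    have := (h.tendsto_p.abs.mul tendsto_inv_atTop_zero).const_mul (Lam * ν / lam)
    simpa [div_eq_mul_inv] using this
  have h3 : Tendsto (fun r => pucciField lam Lam ν g r (u r) (p r) + pucciForce lam Lam g (u r))
      atTop (𝓝 0) := by
    refine squeeze_zero_norm' ?_ h2
    filter_upwards [eventually_gt_atTop 0] with r hr
    exact abs_pucciField_add_pucciForce_le h.lam_pos h.lam_le hν hr g (u r) (p r)
  simpa using h3.sub h1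

/-- If `g` has positive slope at `0`, then `u` has zeros arbitrarily far out: otherwise
`arctan (u' / u)` would decrease at a linear rate. -/
lemma exists_zero (h : PucciSolution lam Lam ν α g ⊤ u p) {g'0 : ℝ} (hg : HasDerivAt g g'0 0)
    (hg0 : 0 < g'0) (M : ℝ) : ∃ r, M ≤ r ∧ u r = 0 := by
  by_contra! hcon
  have hT : ∀ r : ℝ, (r : EReal) < ⊤ := EReal.coe_lt_top
  have hν : 0 < ν := by linarith [h.one_le]
  have hl := h.lam_pos
  have hL := h.Lam_pos
  set m := g'0 / 2 / Lam with hm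
  have hm0 : 0 < m := by positivity
  have hslope : ∀ᶠ x in 𝓝 (0 : ℝ), x ≠ 0 → g'0 / 2 < g x / x := by
    have h1 := (hasDerivAt_iff_tendsto_slope.1 hg).eventually (lt_mem_nhds (half_lt_self hg0))
    have h2 := eventually_nhdsWithin_iff.1 h1
    filter_upwards [h2] with x hx hx0
    have := hx hx0
    rwa [slope_def_field, h.g_zero, sub_zero, sub_zero] at this
  set κ := Lam * ν / lam with hκ
  have hκ0 : 0 < κ := by positivity
  have hsmall : ∀ᶠ r : ℝ in atTop, κ ^ 2 / (2 * r ^ 2) ≤ m / 2 := by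
    have h1 : Tendsto (fun r : ℝ => κ ^ 2 / (2 * r ^ 2)) atTop (𝓝 0) :=
      tendsto_const_nhds.div_atTop ((tendsto_pow_atTop two_ne_zero).const_mul_atTop two_pos)
    filter_upwards [h1.eventually_lt_const (half_pos hm0)] with r hr using hr.le
  obtain ⟨T, hTall⟩ := eventually_atTop.1 ((h.tendsto_u.eventually hslope).and
    (hsmall.and ((eventually_ge_atTop M).and (eventually_gt_atTop 0))))
  set k := min (1 / 2) (m / 2) with hk
  have hk0 : 0 < k := by positivity
  set W : ℝ → ℝ := fun r => Real.arctan (p r / u r) + k * r with hW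
  have hWd : ∀ r, T ≤ r → ∃ w, HasDerivAt W w r ∧ w ≤ 0 := by
    intro r hr
    obtain ⟨hs, hsm, hM, hr0⟩ := hTall r hr
    have hu0 : u r ≠ 0 := hcon r hM
    have hu := h.u_deriv r hr0 (hT r)
    have hp := h.p_deriv r hr0 (hT r)
    set F := pucciField lam Lam ν g r (u r) (p r) with hF
    set f := pucciForce lam Lam g (u r) with hf
    refine ⟨_, ((hp.div hu hu0).arctan).add ((hasDerivAt_id r).const_mul k), ?_⟩
    set y := p r / u r with hy
    have hu2 : 0 < u r ^ 2 := by positivity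
    have hforce : m * u r ^ 2 ≤ u r * f := by
      refine le_trans ?_ (h.mul_div_le_mul_force (h.abs_lt_alpha hr0.le (hT r)))
      rw [hm, div_mul_eq_mul_div]
      refine div_le_div_of_nonneg_right ?_ hL.le
      have h1 := mul_le_mul_of_nonneg_right (hs hu0).le hu2.le
      have h2 : g (u r) / u r * u r ^ 2 = u r * g (u r) := by field_simp
      linarith
    have hFf : u r * F ≤ κ * (|y| / r) * u r ^ 2 - m * u r ^ 2 := by
      have h1 := abs_pucciField_add_pucciForce_le h.lam_pos h.lam_le hν hr0 g (u r) (p r)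
      have h2 : |u r * (F + f)| ≤ κ * (|y| / r) * u r ^ 2 := by
        rw [abs_mul]
        calc |u r| * |F + f| ≤ |u r| * (κ * (|p r| / r)) := by gcongr
          _ = κ * (|y| / r) * u r ^ 2 := by
            rw [hy, abs_div, ← sq_abs (u r)]
            have := abs_pos.2 hu0
            field_simp
      linarith [le_abs_self (u r * (F + f))]
    have hy' : (F * u r - p r * p r) / u r ^ 2 ≤ κ * (|y| / r) - m - y ^ 2 := by
      rw [div_le_iff₀ hu2]
      have h1 : y ^ 2 * u r ^ 2 = p r * p r := by rw [hy]; field_simp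
      nlinarith
    have hamgm : κ * (|y| / r) ≤ y ^ 2 / 2 + κ ^ 2 / (2 * r ^ 2) := by
      have h1 := sq_nonneg (|y| - κ / r)
      have h2 : κ * (|y| / r) = |y| * (κ / r) := by ring
      have h3 : κ ^ 2 / (2 * r ^ 2) = (κ / r) ^ 2 / 2 := by ring
      rw [h2, h3, ← sq_abs y]
      nlinarith
    have hbound : (F * u r - p r * p r) / u r ^ 2 ≤ -k * (1 + y ^ 2) := by
      have h1 : k ≤ m / 2 := min_le_right _ _
      have h2 : k * y ^ 2 ≤ 1 / 2 * y ^ 2 :=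
        mul_le_mul_of_nonneg_right (min_le_left _ _) (sq_nonneg y)
      nlinarith
    have hpos : 0 < 1 + y ^ 2 := by positivity
    have h4 : 1 / (1 + y ^ 2) * ((F * u r - p r * p r) / u r ^ 2) ≤ -k := by
      rw [one_div, inv_mul_le_iff₀ hpos]
      linarith
    simp only [mul_one, Pi.div_apply, ← hy]
    linarith
  have hWanti : AntitoneOn W (Ici T) := by
    refine antitoneOn_of_deriv_nonpos (convex_Ici T) ?_ ?_ ?_
    · intro r hr
      obtain ⟨w, hw, -⟩ := hWd r hr
      exact hw.continuousAt.continuousWithinAt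
    · intro r hr
      obtain ⟨w, hw, -⟩ := hWd r (interior_subset hr)
      exact hw.differentiableAt.differentiableWithinAt
    · intro r hr
      obtain ⟨w, hw, hw0⟩ := hWd r (interior_subset hr)
      rwa [hw.deriv]
  obtain ⟨r, hr1, hr2⟩ := (((tendsto_id.const_mul_atTop hk0).eventually_gt_atTop
    (W T + Real.pi / 2)).and (eventually_ge_atTop T)).exists
  have h1 : W r ≤ W T := hWanti (mem_Ici.2 le_rfl) hr2 hr2
  have h2 := Real.neg_pi_div_two_lt_arctan (p r / u r)
  simp only [hW, id] at h1 hr1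
  linarith

lemma exists_bound_lt_alpha (h : PucciSolution lam Lam ν α g ⊤ u p) :
    ∃ c < α, ∀ r, 0 ≤ r → |u r| ≤ c := by
  have hα := h.alpha_pos
  have h1 : ∀ᶠ r in atTop, |u r| < α / 2 := by
    have := h.tendsto_u.abs
    rw [abs_zero] at this
    exact this.eventually_lt_const (half_pos hα)
  obtain ⟨T, hT⟩ := eventually_atTop.1 (h1.and (eventually_ge_atTop 0))
  obtain ⟨z, hz, hzmax⟩ := (isCompact_Icc (a := 0) (b := T)).exists_isMaxOn
    ⟨0, le_rfl, (hT T le_rfl).2⟩ (h.u_cont.mono (Icc_subset (EReal.coe_lt_top T))).abs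
  refine ⟨max (α / 2) |u z|, max_lt (half_lt_self hα) (h.abs_lt_alpha hz.1 (EReal.coe_lt_top z)),
    fun r hr => ?_⟩
  rcases le_total r T with hrT | hrT
  · exact (show |u r| ≤ |u z| from hzmax ⟨hr, hrT⟩).trans (le_max_right _ _)
  · exact (hT r hrT).1.le.trans (le_max_left _ _)

end PucciSolution

lemma uniqueDiffOn_initial_segment {b : EReal} (hb : 0 < b) :
    UniqueDiffOn ℝ {r : ℝ | 0 ≤ r ∧ (r : EReal) < b} := by
  refine uniqueDiffOn_convex ?_ ?_
  · refine Set.OrdConnected.convex ⟨fun x hx y hy z hz => ⟨hx.1.trans hz.1, ?_⟩⟩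
    exact (EReal.coe_le_coe_iff.2 hz.2).trans_lt hy.2
  · obtain ⟨c, hc0, hcb⟩ := EReal.lt_iff_exists_real_btwn.1 hb
    have hc0' : 0 < c := by exact_mod_cast hc0
    refine ⟨c / 2, mem_interior_iff_mem_nhds.2 ?_⟩
    filter_upwards [Ioo_mem_nhds (half_pos hc0') (half_lt_self hc0')] with x hx
    exact ⟨hx.1.le, (EReal.coe_lt_coe_iff.2 hx.2).trans hcb⟩

lemma initial_segment_mem_nhds {b : EReal} {r : ℝ} (hr : 0 < r) (hrb : (r : EReal) < b) :
    {r : ℝ | 0 ≤ r ∧ (r : EReal) < b} ∈ 𝓝 r := by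
  filter_upwards [Ioi_mem_nhds hr,
    continuous_coe_real_ereal.continuousAt.eventually (gt_mem_nhds hrb)] with x hx hx'
  exact ⟨le_of_lt hx, hx'⟩

/-- A bounded second derivative forces the one-sided derivative at `0` to vanish, because of the
singular drift term. -/
lemma eq_zero_of_singular_equation {lam Lam ν c : ℝ} (hlam : 0 < lam) (hL : lam ≤ Lam)
    (hν : 1 ≤ ν) (hc : 0 < c) {p q f : ℝ → ℝ} (hp : ContinuousOn p (Icc 0 c))
    (hq : ContinuousOn q (Icc 0 c)) (hf : ContinuousOn f (Icc 0 c))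
    (heq : ∀ r ∈ Ioo 0 c, (if 0 ≤ q r then lam else Lam) * q r
      + ν / r * ((if 0 ≤ p r then lam else Lam) * p r) + f r = 0) : p 0 = 0 := by
  have hLam := hlam.trans_le hL
  obtain ⟨B, hB⟩ := isCompact_Icc.exists_bound_of_continuousOn hq
  obtain ⟨D, hD⟩ := isCompact_Icc.exists_bound_of_continuousOn hf
  have hlim : Tendsto p (𝓝[>] 0) (𝓝 (p 0)) := by
    refine (hp 0 ⟨le_rfl, hc.le⟩).tendsto.mono_left ?_
    rw [← nhdsWithin_Ioo_eq_nhdsGT hc]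
    exact nhdsWithin_mono _ Ioo_subset_Icc_self
  have hsmall : Tendsto (fun r : ℝ => r * ((Lam * B + D) / lam)) (𝓝[>] 0) (𝓝 0) := by
    have : ContinuousAt (fun r : ℝ => r * ((Lam * B + D) / lam)) 0 := by fun_prop
    simpa using this.tendsto.mono_left (nhdsWithin_le_nhds (s := Ioi 0))
  refine tendsto_nhds_unique hlim (squeeze_zero_norm' ?_ hsmall)
  filter_upwards [Ioo_mem_nhdsGT hc] with r hr
  have hr0 := hr.1
  have h1 := heq r hr
  have h2 := hB r (Ioo_subset_Icc_self hr)
  have h3 := hD r (Ioo_subset_Icc_self hr)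
  rw [Real.norm_eq_abs] at *
  have habs : ∀ y : ℝ, lam * |y| ≤ |(if 0 ≤ y then lam else Lam) * y| ∧
      |(if 0 ≤ y then lam else Lam) * y| ≤ Lam * |y| := by
    intro y
    rw [abs_mul]
    have := abs_nonneg y
    split_ifs
    · rw [abs_of_pos hlam]; exact ⟨le_rfl, by gcongr⟩
    · rw [abs_of_pos hLam]; exact ⟨by gcongr, le_rfl⟩
  set X := (if 0 ≤ q r then lam else Lam) * q r
  set Y := (if 0 ≤ p r then lam else Lam) * p r
  have hX : |X| ≤ Lam * B := (habs (q r)).2.trans (by gcongr)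
  have hY : lam * |p r| ≤ |Y| := (habs (p r)).1
  have h4 : ν * Y = -(r * (X + f r)) := by
    field_simp at h1
    linarith
  have h5 : |Y| ≤ |ν * Y| := by
    rw [abs_mul ν Y]
    exact le_mul_of_one_le_left (abs_nonneg _) (hν.trans (le_abs_self ν))
  rw [h4, abs_neg, abs_mul r, abs_of_pos hr0] at h5
  have h6 : |X + f r| ≤ Lam * B + D := (abs_add_le _ _).trans (add_le_add hX h3)
  have h7 : r * |X + f r| ≤ r * (Lam * B + D) := by gcongr
  rw [mul_div_assoc', le_div_iff₀ hlam]
  linarith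

lemma PucciData.contDiffOn_two {lam Lam ν α : ℝ} {g : ℝ → ℝ} (h : PucciData lam Lam ν α g)
    {c : ℝ} {v w : ℝ → ℝ} (hvw : ∀ r ∈ Ioo 0 c,
      HasDerivAt v (w r) r ∧ HasDerivAt w (pucciField lam Lam ν g r (v r) (w r)) r) :
    ContDiffOn ℝ 2 v (Ioo 0 c) := by
  have hv : ContinuousOn v (Ioo 0 c) := fun r hr => (hvw r hr).1.continuousAt.continuousWithinAt
  have hw : ContinuousOn w (Ioo 0 c) := fun r hr => (hvw r hr).2.continuousAt.continuousWithinAt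
  have hF : ContinuousOn (fun r => pucciField lam Lam ν g r (v r) (w r)) (Ioo 0 c) :=
    (lipschitzWith_pucciInv h.lam_pos h.lam_le).continuous.comp_continuousOn
      ((h.lip.continuous.comp_continuousOn hv).add
        ((lipschitzWith_pucciDrift lam Lam).continuous.comp_continuousOn
          ((continuousOn_const.mul hw).div continuousOn_id fun r hr => hr.1.ne'))).neg
  have hw1 : ContDiffOn ℝ 1 w (Ioo 0 c) := by
    rw [contDiffOn_one_iff_derivWithin isOpen_Ioo.uniqueDiffOn]
    refine ⟨fun r hr => (hvw r hr).2.differentiableAt.differentiableWithinAt, hF.congr ?_⟩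
    intro r hr
    rw [derivWithin_of_isOpen isOpen_Ioo hr, (hvw r hr).2.deriv]
  refine (contDiffOn_succ_iff_deriv_of_isOpen (n := 1) isOpen_Ioo).2
    ⟨fun r hr => (hvw r hr).1.differentiableAt.differentiableWithinAt, by simp, hw1.congr ?_⟩
  exact fun r hr => (hvw r hr).1.deriv

theorem pucci_radial_minus_oscillating_negative_data
    (lam Lam : ℝ) (hlam : 0 < lam) (hlamLam : lam ≤ Lam)
    (N : ℕ) (hN : 2 ≤ N)
    (g : ℝ → ℝ) (hg1 : LocallyLipschitz g)
    (hg2 : ∀ t, g (-t) = - g t)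
    (α : ℝ) (hα : 0 < α)
    (hg3pos : ∀ t, 0 < t → t < α → 0 < g t)
    (hg3neg : ∀ t, α < t → g t < 0)
    (g'0 : ℝ) (hg4 : HasDerivAt g g'0 0) (hg4pos : 0 < g'0)
    (G : ℝ → ℝ) (hG : ∀ t, G t = ∫ s in (0:ℝ)..t, g s)
    (ξ : ℝ) (hξα : -α < ξ) (hξ0 : ξ < 0)
    (hGle : Lam * G ξ ≤ lam * G α)
    (R : EReal) (hR : 0 < R)
    (u : ℝ → ℝ)
    (hu : ContDiffOn ℝ 2 u {r : ℝ | 0 ≤ r ∧ (r : EReal) < R})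
    (hode : ∀ r : ℝ, 0 < r → (r : EReal) < R →
      (if 0 ≤ deriv (deriv u) r then lam else Lam) * deriv (deriv u) r
        + ((N : ℝ) - 1) / r * ((if 0 ≤ deriv u r then lam else Lam) * deriv u r)
        + g (u r) = 0)
    (hu0 : u 0 = ξ) (hu'0 : deriv u 0 = 0)
    (hmax : ¬ ∃ (R' : EReal) (v : ℝ → ℝ), R < R' ∧
      ContDiffOn ℝ 2 v {r : ℝ | 0 ≤ r ∧ (r : EReal) < R'} ∧
      (∀ r : ℝ, 0 < r → (r : EReal) < R' →
        (if 0 ≤ deriv (deriv v) r then lam else Lam) * deriv (deriv v) r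
        + ((N : ℝ) - 1) / r * ((if 0 ≤ deriv v r then lam else Lam) * deriv v r)
        + g (v r) = 0) ∧
      v 0 = ξ ∧ deriv v 0 = 0 ∧
      (∀ r : ℝ, 0 ≤ r → (r : EReal) < R → v r = u r))
 :
    R = ⊤ ∧
    (∀ M : ℝ, ∃ r, M ≤ r ∧ u r = 0) ∧
    Tendsto u atTop (𝓝 0) ∧ Tendsto (deriv u) atTop (𝓝 0) ∧
    Tendsto (deriv (deriv u)) atTop (𝓝 0) ∧
    sSup ((fun r => |u r|) '' Set.Ici 0) < α := by
  have hLam : 0 < Lam := hlam.trans_le hlamLam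
  have hν : (1 : ℝ) ≤ (N : ℝ) - 1 := by
    have : (2 : ℝ) ≤ N := by exact_mod_cast hN
    linarith
  have hg0 : g 0 = 0 := by
    have := hg2 0
    rw [neg_zero] at this
    linarith
  have hdata : PucciData lam Lam ((N : ℝ) - 1) α g :=
    { lam_pos := hlam
      lam_le := hlamLam
      one_le := hν
      alpha_pos := hα
      lip := hg1
      g_zero := hg0
      g_pos := hg3pos
      g_neg := fun x hx hx0 => by
        have := hg3pos (-x) (by linarith) (by linarith)
        rw [hg2] at this
        linarith }
  set S : Set ℝ := {r : ℝ | 0 ≤ r ∧ (r : EReal) < R} with hS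
  have hSd : UniqueDiffOn ℝ S := uniqueDiffOn_initial_segment hR
  set p : ℝ → ℝ := derivWithin u S with hp
  set q : ℝ → ℝ := derivWithin p S with hq
  obtain ⟨hud, -, hpC⟩ := (contDiffOn_succ_iff_derivWithin (n := 1) hSd).1 hu
  obtain ⟨hpd, hqc⟩ := (contDiffOn_one_iff_derivWithin hSd).1 hpC
  have hnhds : ∀ r : ℝ, 0 < r → (r : EReal) < R → S ∈ 𝓝 r := fun r => initial_segment_mem_nhds
  have hud' : ∀ r : ℝ, 0 < r → (r : EReal) < R → HasDerivAt u (p r) r := fun r h0 hr =>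
    ((hud r ⟨h0.le, hr⟩).hasDerivWithinAt).hasDerivAt (hnhds r h0 hr)
  have hpd' : ∀ r : ℝ, 0 < r → (r : EReal) < R → HasDerivAt p (q r) r := fun r h0 hr =>
    ((hpd r ⟨h0.le, hr⟩).hasDerivWithinAt).hasDerivAt (hnhds r h0 hr)
  have hdd : ∀ r : ℝ, 0 < r → (r : EReal) < R → deriv (deriv u) r = q r := by
    intro r h0 hr
    have : deriv u =ᶠ[𝓝 r] p := by
      filter_upwards [hnhds r h0 hr, Ioi_mem_nhds h0] with x hx hx0
      exact (hud' x hx0 hx.2).deriv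
    rw [this.deriv_eq, (hpd' r h0 hr).deriv]
  have hode' : ∀ r : ℝ, 0 < r → (r : EReal) < R →
      (if 0 ≤ q r then lam else Lam) * q r
        + ((N : ℝ) - 1) / r * ((if 0 ≤ p r then lam else Lam) * p r) + g (u r) = 0 := by
    intro r h0 hr
    have := hode r h0 hr
    rwa [hdd r h0 hr, (hud' r h0 hr).deriv] at this
  have hp0 : p 0 = 0 := by
    obtain ⟨c, hc0, hcR⟩ := EReal.lt_iff_exists_real_btwn.1 hR
    have hc0' : 0 < c := by exact_mod_cast hc0
    have hsub : Icc 0 c ⊆ S := PucciSolution.Icc_subset hcR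
    exact eq_zero_of_singular_equation hlam hlamLam hν hc0' (hpC.continuousOn.mono hsub)
      (hqc.mono hsub) (hg1.continuous.comp_continuousOn (hu.continuousOn.mono hsub))
      fun r hr => hode' r hr.1 (hsub (Ioo_subset_Icc_self hr)).2
  have hsol : PucciSolution lam Lam ((N : ℝ) - 1) α g R u p :=
    { hdata with
      u_cont := hu.continuousOn
      p_cont := hpC.continuousOn
      p_zero := hp0
      u_deriv := hud'
      p_deriv := fun r h0 hr => (hpd' r h0 hr).congr_deriv
        ((pucci_equation_iff hlam hlamLam (by linarith) h0 g _ _ _).1 (hode' r h0 hr))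
      u_zero_gt := by rwa [hu0]
      u_zero_lt := by rwa [hu0]
      potential_le := by
        rw [hu0, hdata.potential_of_neg hξα hξ0, hdata.potential_alpha, ← hG, ← hG,
          div_le_div_iff₀ hlam hLam]
        linarith }
  have hRtop : R = ⊤ := by
    by_contra hne
    obtain ⟨β, rfl⟩ : ∃ β : ℝ, (β : EReal) = R :=
      ⟨R.toReal, EReal.coe_toReal hne (bot_le.trans_lt hR).ne'⟩
    have hβ : 0 < β := by exact_mod_cast hR
    obtain ⟨c, hc, v, w, hvu, hvw⟩ := hsol.exists_extension hβ
    have hveq : ∀ r < β, v =ᶠ[𝓝 r] u := fun r hr => by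
      filter_upwards [Iio_mem_nhds hr] with x hx using hvu x hx
    have hvdd : ∀ r ∈ Ioo 0 c,
        deriv (deriv v) r = pucciField lam Lam ((N : ℝ) - 1) g r (v r) (w r) := by
      intro r hr
      have : deriv v =ᶠ[𝓝 r] w := by
        filter_upwards [Ioo_mem_nhds hr.1 hr.2] with x hx using (hvw x hx).1.deriv
      rw [this.deriv_eq, (hvw r hr).2.deriv]
    refine hmax ⟨c, v, EReal.coe_lt_coe_iff.2 hc, ?_, ?_, ?_, ?_, ?_⟩
    · rintro r ⟨h0, hrc⟩
      rcases lt_or_ge r β with hrβ | hrβ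
      · have h1 : ContDiffWithinAt ℝ 2 u S r := hu r ⟨h0, EReal.coe_lt_coe_iff.2 hrβ⟩
        refine (h1.mono_of_mem_nhdsWithin ?_).congr_of_eventuallyEq
          ((hveq r hrβ).filter_mono nhdsWithin_le_nhds) (hvu r hrβ)
        filter_upwards [self_mem_nhdsWithin, nhdsWithin_le_nhds (Iio_mem_nhds hrβ)] with x hx hx'
        exact ⟨hx.1, EReal.coe_lt_coe_iff.2 hx'⟩
      · have hr : r ∈ Ioo 0 c := ⟨by linarith, EReal.coe_lt_coe_iff.1 hrc⟩
        exact ((hdata.contDiffOn_two hvw).contDiffAt (Ioo_mem_nhds hr.1 hr.2)).contDiffWithinAt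
    · intro r h0 hrc
      have hr : r ∈ Ioo 0 c := ⟨h0, EReal.coe_lt_coe_iff.1 hrc⟩
      rw [(hvw r hr).1.deriv]
      exact (pucci_equation_iff hlam hlamLam (by linarith) h0 g _ _ _).2 (hvdd r hr)
    · rw [hvu 0 hβ, hu0]
    · rw [(hveq 0 hβ).deriv_eq, hu'0]
    · exact fun r _ hr => hvu r (EReal.coe_lt_coe_iff.1 hr)
  subst hRtop
  have hT : ∀ r : ℝ, (r : EReal) < ⊤ := EReal.coe_lt_top
  refine ⟨rfl, hsol.exists_zero hg4 hg4pos, hsol.tendsto_u, hsol.tendsto_p.congr' ?_,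
    hsol.tendsto_field.congr' ?_, ?_⟩
  · filter_upwards [eventually_gt_atTop 0] with r hr using (hud' r hr (hT r)).deriv.symm
  · filter_upwards [eventually_gt_atTop 0] with r hr
    rw [hdd r hr (hT r)]
    exact (hsol.p_deriv r hr (hT r)).unique (hpd' r hr (hT r))
  · obtain ⟨c, hcα, hc⟩ := hsol.exists_bound_lt_alpha
    refine (csSup_le (nonempty_Ici.image _) ?_).trans_lt hcα
    rintro _ ⟨r, hr, rfl⟩
    exact hc r hr
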